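/- arXiv:1609.08230 — 2 statements merged into one kernel-verified Lean document; each statement's English description precedes it below -/
import Mathlib

section
/- There exists an absolute constant C > 0 with the following property. Let α be an irrational real number and let q_n denote the denominators of the convergents of its continued fraction expansion, and assume q_n ≥ 2. Let k₁ < k₂ < ⋯ < k_m be integers with k_m − k₁ < q_n, and let x ∈ ℝ be such that ‖k_j·α − x‖ ≥ 1/(4·q_n) for every j ∈ {1,…,m}. Then Σ_{j=1}^{m} 1/‖k_j·α − x‖ ≤ C·q_n·ln(q_n). -/
open Filter

/-- Distance from a real number to the nearest integer. -/
noncomputable def nint (x : ℝ) : ℝ := |x - (round x : ℝ)|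

/-- The Gauss map orbit of `θ`: `cfX θ 0 = θ` and `cfX θ (k+1) = 1 / (fractional part of cfX θ k)`. -/
noncomputable def cfX (θ : ℝ) : ℕ → ℝ
  | 0 => θ
  | k + 1 => (Int.fract (cfX θ k))⁻¹

/-- The partial quotients of the continued fraction expansion of `θ`. -/
noncomputable def cfA (θ : ℝ) (k : ℕ) : ℤ := ⌊cfX θ k⌋

/-- The denominators of the convergents of the continued fraction expansion of `θ`:
`q₀ = 1`, `q₁ = a₁`, `q_{k+2} = a_{k+2} q_{k+1} + q_k`. -/
noncomputable def cfQ (θ : ℝ) : ℕ → ℤ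
  | 0 => 1
  | 1 => cfA θ 1
  | (k + 2) => cfA θ (k + 2) * cfQ θ (k + 1) + cfQ θ k

theorem irrational_cfX {α : ℝ} (h : Irrational α) (k : ℕ) : Irrational (cfX α k) := by
  induction k with
  | zero => exact h
  | succ k ih =>
    rw [cfX, irrational_inv_iff, Int.fract]
    exact ih.sub_intCast _

theorem one_lt_cfX_succ {α : ℝ} (h : Irrational α) (k : ℕ) : 1 < cfX α (k + 1) := by
  have h0 : Int.fract (cfX α k) ≠ 0 := by
    intro h0
    have := irrational_cfX h (k + 1)
    rw [cfX, h0, inv_zero] at this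
    exact not_irrational_zero this
  rw [cfX]
  exact (one_lt_inv₀ ((Int.fract_nonneg _).lt_of_ne' h0)).2 (Int.fract_lt_one _)

theorem one_le_cfA_succ {α : ℝ} (h : Irrational α) (k : ℕ) : 1 ≤ cfA α (k + 1) := by
  rw [cfA, Int.le_floor]
  exact_mod_cast (one_lt_cfX_succ h k).le

theorem cfX_succ_mul {α : ℝ} (h : Irrational α) (k : ℕ) :
    cfX α (k + 1) * cfX α k = cfX α (k + 1) * cfA α k + 1 := by
  have h1 : cfX α (k + 1) * Int.fract (cfX α k) = 1 := by
    have h2 := one_lt_cfX_succ h k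
    rw [cfX] at h2 ⊢
    refine inv_mul_cancel₀ fun h0 => ?_
    rw [h0, inv_zero] at h2
    linarith
  rw [Int.fract] at h1
  rw [cfA]
  linarith

/-- Consecutive convergents `a / cfQ α n` and `b / cfQ α (n + 1)` have determinant `±1`, and `α` is
recovered from them and the complete quotient. -/
theorem exists_consecutive_convergents {α : ℝ} (h : Irrational α) (n : ℕ) :
    1 ≤ cfQ α n ∧ 1 ≤ cfQ α (n + 1) ∧ ∃ a b : ℤ,
      |b * cfQ α n - a * cfQ α (n + 1)| = 1 ∧
      α * (cfX α (n + 2) * cfQ α (n + 1) + cfQ α n) = cfX α (n + 2) * b + a := by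
  induction n with
  | zero =>
    refine ⟨le_rfl, one_le_cfA_succ h 0, cfA α 0, cfA α 1 * cfA α 0 + 1, ?_, ?_⟩
    · rw [show (cfA α 1 * cfA α 0 + 1) * cfQ α 0 - cfA α 0 * cfQ α (0 + 1) = 1 by
        simp only [cfQ]; ring]
      rfl
    · have h0 : cfX α 1 * α = cfX α 1 * cfA α 0 + 1 := cfX_succ_mul h 0
      have h1 : cfX α 2 * cfX α 1 = cfX α 2 * cfA α 1 + 1 := cfX_succ_mul h 1
      simp only [cfQ, Nat.zero_add]
      push_cast
      linear_combination cfX α 2 * h0 - (α - cfA α 0) * h1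
  | succ n ih =>
    obtain ⟨h0, h1, a, b, hdet, heq⟩ := ih
    have hA := one_le_cfA_succ h (n + 1)
    have hQ : cfQ α (n + 1 + 1) = cfA α (n + 2) * cfQ α (n + 1) + cfQ α n := rfl
    refine ⟨h1, ?_, b, cfA α (n + 2) * b + a, ?_, ?_⟩
    · rw [hQ]
      nlinarith
    · rw [← hdet, ← abs_neg, hQ]
      congr 1
      ring
    · have h2 : cfX α (n + 3) * cfX α (n + 2) = cfX α (n + 3) * cfA α (n + 2) + 1 :=
        cfX_succ_mul h (n + 2)
      rw [hQ, show n + 1 + 2 = n + 3 from rfl]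
      push_cast
      linear_combination cfX α (n + 3) * heq - (α * cfQ α (n + 1) - b) * h2

theorem exists_isCoprime_abs_mul_cfQ_sub_le {α : ℝ} (h : Irrational α) {n : ℕ} (hn : n ≠ 0) :
    ∃ p : ℤ, IsCoprime p (cfQ α n) ∧ |α * cfQ α n - p| ≤ 1 / cfQ α n := by
  obtain ⟨n, rfl⟩ := Nat.exists_eq_succ_of_ne_zero hn
  obtain ⟨h0, h1, a, b, hdet, heq⟩ := exists_consecutive_convergents h n
  refine ⟨b, ?_, ?_⟩
  · rcases (abs_eq zero_le_one).1 hdet with hd | hd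
    · exact ⟨cfQ α n, -a, by linear_combination hd⟩
    · exact ⟨-cfQ α n, a, by linear_combination -hd⟩
  · have h0' : (1 : ℝ) ≤ cfQ α n := by exact_mod_cast h0
    have h1' : (1 : ℝ) ≤ cfQ α (n + 1) := by exact_mod_cast h1
    have hX := one_lt_cfX_succ h (n + 1)
    have hdet' : |(b * cfQ α n - a * cfQ α (n + 1) : ℝ)| = 1 := by exact_mod_cast hdet
    have hD : (cfQ α (n + 1) : ℝ) ≤ cfX α (n + 2) * cfQ α (n + 1) + cfQ α n := by nlinarith
    have key : |α * cfQ α (n + 1) - b| * (cfX α (n + 2) * cfQ α (n + 1) + cfQ α n) = 1 := by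
      rw [← hdet', ← abs_neg (_ - _ * _),
        ← abs_of_nonneg (show 0 ≤ cfX α (n + 2) * cfQ α (n + 1) + cfQ α n by linarith), ← abs_mul]
      congr 1
      linear_combination cfQ α (n + 1) * heq
    rw [Nat.succ_eq_add_one, le_div_iff₀ (by linarith), ← key]
    gcongr

theorem sum_inv_abs_add_one_le {ι : Type*} (s : Finset ι) (N : ι → ℤ) (hN : Set.InjOn N s)
    (M : ℕ) (hM : ∀ i ∈ s, |N i| ≤ M) :
    ∑ i ∈ s, (|(N i : ℝ)| + 1)⁻¹ ≤ 2 * (1 + Real.log (M + 1)) := by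
  classical
  have part : ∀ t ⊆ s, Set.InjOn (fun i => (N i).natAbs) t →
      ∑ i ∈ t, (|(N i : ℝ)| + 1)⁻¹ ≤ 1 + Real.log (M + 1) := by
    intro t ht hinj
    calc ∑ i ∈ t, (|(N i : ℝ)| + 1)⁻¹
        = ∑ i ∈ t, (((N i).natAbs : ℝ) + 1)⁻¹ := by simp [Nat.cast_natAbs]
      _ = ∑ r ∈ t.image (fun i => (N i).natAbs), ((r : ℝ) + 1)⁻¹ :=
          (Finset.sum_image (f := fun r : ℕ => ((r : ℝ) + 1)⁻¹) hinj).symm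
      _ ≤ ∑ r ∈ Finset.range (M + 1), ((r : ℝ) + 1)⁻¹ := by
          refine Finset.sum_le_sum_of_subset_of_nonneg ?_ fun r _ _ => by positivity
          intro r hr
          obtain ⟨i, hi, rfl⟩ := Finset.mem_image.1 hr
          have := hM i (ht hi)
          rw [Int.abs_eq_natAbs] at this
          rw [Finset.mem_range]
          omega
      _ = (harmonic (M + 1) : ℝ) := by simp [harmonic]
      _ ≤ 1 + Real.log (M + 1) := by exact_mod_cast harmonic_le_one_add_log (M + 1)
  rw [← Finset.sum_filter_add_sum_filter_not s (fun i => 0 ≤ N i), two_mul]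
  refine add_le_add (part _ (Finset.filter_subset _ _) ?_) (part _ (Finset.filter_subset _ _) ?_)
  all_goals
    intro i hi j hj hij
    simp only [Finset.coe_filter, Set.mem_ofPred_eq] at hi hj hij
    exact hN hi.1 hj.1 (by omega)

/-- The points `k j * α - x`, scaled by `q` and reduced mod `q`, lie within `2` of distinct
integers when `p / q` is a good approximation of `α` and the `k j` are incongruent mod `q`. -/
theorem exists_injective_int_near {ι : Type*} {α : ℝ} {p q : ℤ} (hq : 0 < q) (hpq : IsCoprime p q)
    (hα : |α * q - p| ≤ 1 / q) (k : ι → ℤ) (hk : Function.Injective k) (k₀ : ℤ)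
    (hk₀ : ∀ j, 0 ≤ k j - k₀ ∧ k j - k₀ < q) (x : ℝ) :
    ∃ N : ι → ℤ, Function.Injective N ∧
      ∀ j, |q * (k j * α - x - round (k j * α - x)) - N j| ≤ 2 := by
  have hq' : (0 : ℝ) < q := by exact_mod_cast hq
  refine ⟨fun j => (k j - k₀) * p - q * round (k j * α - x) + ⌊q * (k₀ * α - x)⌋, ?_, ?_⟩
  · intro i j hij
    have hdvd : q ∣ (k i - k j) * p :=
      ⟨round (k i * α - x) - round (k j * α - x), by linear_combination hij⟩
    have h1 := hpq.symm.dvd_of_dvd_mul_right hdvd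
    have h2 : k i - k j = 0 := by
      refine Int.eq_zero_of_abs_lt_dvd h1 ?_
      rw [abs_lt]
      constructor <;> linarith [hk₀ i, hk₀ j]
    exact hk (by linarith)
  · intro j
    have h0 : (0 : ℝ) ≤ k j - k₀ := by exact_mod_cast (hk₀ j).1
    have h1 : (k j - k₀ : ℝ) ≤ q := by exact_mod_cast (hk₀ j).2.le
    have h2 : |(k j - k₀ : ℝ) * (α * q - p)| ≤ 1 := by
      rw [abs_mul, abs_of_nonneg h0]
      calc (k j - k₀ : ℝ) * |α * q - p| ≤ q * (1 / q) := by gcongr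
        _ = 1 := by field_simp
    have h3 : |Int.fract (q * (k₀ * α - x))| ≤ 1 := by
      rw [abs_of_nonneg (Int.fract_nonneg _)]
      exact (Int.fract_lt_one _).le
    have h4 := abs_add_le ((k j - k₀ : ℝ) * (α * q - p)) (Int.fract (q * (k₀ * α - x)))
    refine le_trans (le_of_eq ?_) (h4.trans (by linarith))
    congr 1
    rw [Int.fract]
    push_cast
    ring

theorem stmt_5 : ∃ C : ℝ, 0 < C ∧
    ∀ α : ℝ, Irrational α → ∀ n : ℕ, 2 ≤ cfQ α n →
    ∀ (m : ℕ) (k : Fin (m + 1) → ℤ), StrictMono k →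
      k (Fin.last m) - k 0 < cfQ α n →
    ∀ x : ℝ, (∀ j : Fin (m + 1), 1 / (4 * (cfQ α n : ℝ)) ≤ nint ((k j : ℝ) * α - x)) →
      ∑ j : Fin (m + 1), 1 / nint ((k j : ℝ) * α - x)
        ≤ C * (cfQ α n : ℝ) * Real.log (cfQ α n : ℝ) := by
  refine ⟨104, by norm_num, fun α hα n hn m k hk hkq x hx => ?_⟩
  have hn0 : n ≠ 0 := by
    rintro rfl
    simp [cfQ] at hn
  obtain ⟨p, hpq, hp⟩ := exists_isCoprime_abs_mul_cfQ_sub_le hα hn0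
  generalize cfQ α n = q at *
  have hq : (2 : ℝ) ≤ q := by exact_mod_cast hn
  obtain ⟨N, hN, hNear⟩ := exists_injective_int_near (by linarith) hpq hp k hk.injective (k 0)
    (fun j => ⟨sub_nonneg.2 (hk.monotone (Fin.zero_le j)),
      (sub_le_sub_right (hk.monotone (Fin.le_last j)) _).trans_lt hkq⟩) x
  have hnear : ∀ j, |(N j : ℝ)| ≤ q * nint (k j * α - x) + 2 := by
    intro j
    have h1 := abs_sub_abs_le_abs_sub (N j : ℝ) (q * (k j * α - x - round (k j * α - x)))
    rw [abs_sub_comm, abs_mul, abs_of_nonneg (by linarith : (0 : ℝ) ≤ q)] at h1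
    have h2 := hNear j
    rw [nint]
    linarith
  have hterm : ∀ j, 1 / nint (k j * α - x) ≤ 13 * q * (|(N j : ℝ)| + 1)⁻¹ := by
    intro j
    have h1 := hx j
    have h2 : 0 < nint (k j * α - x) := lt_of_lt_of_le (by positivity) h1
    rw [div_le_iff₀ (by positivity)] at h1
    rw [← div_eq_mul_inv, div_le_div_iff₀ h2 (by positivity)]
    nlinarith [hnear j]
  have hM : ∀ j ∈ Finset.univ, |N j| ≤ ((q + 1).toNat : ℤ) := by
    intro j _
    rw [Int.toNat_of_nonneg (by linarith)]
    have h1 : nint (k j * α - x) ≤ 1 / 2 := abs_sub_round _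
    have h2 : |(N j : ℝ)| ≤ q + 1 := by nlinarith [hnear j]
    exact_mod_cast h2
  have hsum := sum_inv_abs_add_one_le Finset.univ N hN.injOn _ hM
  have hcast : (((q + 1).toNat : ℕ) : ℝ) = q + 1 := by
    have : (((q + 1).toNat : ℕ) : ℤ) = q + 1 := Int.toNat_of_nonneg (by linarith)
    exact_mod_cast this
  rw [hcast] at hsum
  have hlog2 : Real.log 2 ≤ Real.log q := Real.log_le_log (by norm_num) hq
  have hlog : Real.log (q + 1 + 1) ≤ 2 * Real.log q := by
    calc Real.log (q + 1 + 1) ≤ Real.log (2 * q) :=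
          Real.log_le_log (by linarith) (by linarith)
      _ = Real.log 2 + Real.log q := Real.log_mul (by norm_num) (by linarith)
      _ ≤ 2 * Real.log q := by linarith
  have hone : 1 ≤ 2 * Real.log q := by linarith [Real.log_two_gt_d9]
  calc ∑ j, 1 / nint (k j * α - x) ≤ ∑ j, 13 * q * (|(N j : ℝ)| + 1)⁻¹ :=
        Finset.sum_le_sum fun j _ => hterm j
    _ = 13 * q * ∑ j, (|(N j : ℝ)| + 1)⁻¹ := (Finset.mul_sum _ _ _).symm
    _ ≤ 13 * q * (8 * Real.log q) := by
        gcongr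
        linarith
    _ = 104 * q * Real.log q := by ring
end

section
/- Let C₀, C₁, C₂ ∈ ℂ∖{0}, and let α, β be real numbers with β ≠ 0 and α/β irrational, satisfying liminf_{n→∞} n·ln(n)·min{‖n·β/α‖, ‖n·α/β‖} < ∞. Define P(x) = C₀ + C₁·e^{2πiαx} + C₂·e^{2πiβx}. Suppose f : ℝ → ℂ is measurable and satisfies f(x+1) = f(x)·P(x) for almost every x ∈ ℝ, and lim_{|n|→∞, n ∈ ℤ} f(x+n) = 0 for almost every x ∈ [0,1). Then f = 0 almost everywhere. -/
open MeasureTheory Filter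

/-- The character `x ↦ exp (2πix)` of the real line. -/
noncomputable def unitExp (x : ℝ) : ℂ := Complex.exp (Complex.I * ((2 * Real.pi * x : ℝ) : ℂ))

lemma unitExp_add (x y : ℝ) : unitExp (x + y) = unitExp x * unitExp y := by
  rw [unitExp, unitExp, unitExp, ← Complex.exp_add]
  congr 1
  push_cast
  ring

lemma norm_unitExp (x : ℝ) : ‖unitExp x‖ = 1 := by
  rw [unitExp, mul_comm, Complex.norm_exp_ofReal_mul_I]

lemma unitExp_int (n : ℤ) : unitExp n = 1 := by
  rw [unitExp, Complex.exp_eq_one_iff]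
  exact ⟨n, by push_cast; ring⟩

lemma unitExp_add_int (x : ℝ) (n : ℤ) : unitExp (x + n) = unitExp x := by
  rw [unitExp_add, unitExp_int, mul_one]

@[fun_prop]
lemma continuous_unitExp : Continuous unitExp := by
  unfold unitExp
  fun_prop

lemma norm_unitExp_sub_one_le (x : ℝ) (n : ℤ) : ‖unitExp x - 1‖ ≤ 2 * Real.pi * |x - n| := by
  have h : unitExp x = unitExp (x - n) := by
    rw [← unitExp_add_int (x - n) n, sub_add_cancel]
  rw [h, unitExp]
  refine Real.norm_exp_I_mul_ofReal_sub_one_le.trans ?_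
  rw [Real.norm_eq_abs, abs_mul, abs_of_pos (by positivity : 0 < 2 * Real.pi)]

lemma four_mul_nint_le_norm_unitExp_sub_one (x : ℝ) : 4 * nint x ≤ ‖unitExp x - 1‖ := by
  have h : unitExp x = unitExp (x - round x) := by
    rw [← unitExp_add_int (x - round x) (round x), sub_add_cancel]
  have hpi := Real.pi_pos
  have hr := abs_sub_round x
  have habs : |2 * Real.pi * (x - round x) / 2| = Real.pi * nint x := by
    rw [nint, show 2 * Real.pi * (x - round x) / 2 = Real.pi * (x - round x) by ring, abs_mul,
      abs_of_pos hpi]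
  have hsin := Real.mul_abs_le_abs_sin (x := 2 * Real.pi * (x - round x) / 2) (by
    rw [habs, nint]; nlinarith)
  rw [h, unitExp, Complex.norm_exp_I_mul_ofReal_sub_one, Real.norm_eq_abs, abs_mul,
    abs_of_pos (zero_lt_two' ℝ)]
  rw [habs, ← mul_assoc, div_mul_cancel₀ _ hpi.ne'] at hsin
  linarith

lemma exists_two_mul_nint_le_norm_add (z w : ℂ) :
    ∃ c : ℝ, ∀ x : ℝ, 2 * ‖w‖ * nint (x + c) ≤ ‖z + w * unitExp x‖ := by
  rcases eq_or_ne w 0 with rfl | hw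
  · exact ⟨0, fun x => by simp⟩
  set u : ℂ := -z / w with hu
  have hz : z = -(w * u) := by rw [hu]; field_simp
  have hu' : u = ‖u‖ * unitExp (u.arg / (2 * Real.pi)) := by
    conv_lhs => rw [← Complex.norm_mul_exp_arg_mul_I u]
    rw [unitExp, mul_div_cancel₀ _ (by positivity), mul_comm Complex.I]
  refine ⟨-(u.arg / (2 * Real.pi)), fun x => ?_⟩
  set c := u.arg / (2 * Real.pi)
  have key : ‖z + w * unitExp x‖ = ‖w‖ * ‖unitExp (x + -c) - ‖u‖‖ := by
    have hx : unitExp x = unitExp (x + -c) * unitExp c := by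
      rw [← unitExp_add, neg_add_cancel_right]
    rw [hz, show -(w * u) + w * unitExp x = w * (unitExp x - u) by ring, norm_mul]
    congr 1
    rw [hx]
    conv_lhs => rw [hu']
    rw [← sub_mul, norm_mul, norm_unitExp, mul_one]
  have h4 := four_mul_nint_le_norm_unitExp_sub_one (x + -c)
  have h1 : ‖((‖u‖ : ℝ) : ℂ) - 1‖ ≤ ‖unitExp (x + -c) - ‖u‖‖ := by
    have := abs_norm_sub_norm_le (unitExp (x + -c)) (‖u‖ : ℂ)
    rw [norm_unitExp, Complex.norm_real, norm_norm] at this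
    rwa [← Complex.ofReal_one, ← Complex.ofReal_sub, Complex.norm_real, Real.norm_eq_abs,
      abs_sub_comm]
  have h2 : ‖unitExp (x + -c) - 1‖ ≤ ‖unitExp (x + -c) - ‖u‖‖ + ‖((‖u‖ : ℝ) : ℂ) - 1‖ :=
    norm_sub_le_norm_sub_add_norm_sub _ _ _
  rw [key, mul_comm 2, mul_assoc]
  gcongr
  linarith

lemma countable_norm_add_mul_unitExp_eq {z w : ℂ} (hz : z ≠ 0) (hw : w ≠ 0) (c : ℝ) :
    {x : ℝ | ‖z + w * unitExp x‖ = c}.Countable := by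
  set v : ℂ := (starRingEnd ℂ) z * w with hv
  have hv0 : ‖v‖ ≠ 0 := by simp [hv, hz, hw]
  have key : ∀ x : ℝ, ‖z + w * unitExp x‖ ^ 2 =
      ‖z‖ ^ 2 + ‖w‖ ^ 2 + 2 * (‖v‖ * Real.cos (v.arg + 2 * Real.pi * x)) := by
    intro x
    have h1 : ((starRingEnd ℂ) z * (w * unitExp x)).re =
        ‖v‖ * Real.cos (v.arg + 2 * Real.pi * x) := by
      rw [← mul_assoc, ← hv]
      conv_lhs => rw [← Complex.norm_mul_exp_arg_mul_I v]
      rw [unitExp, mul_assoc, ← Complex.exp_add, Complex.re_ofReal_mul,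
        show (v.arg : ℂ) * Complex.I + Complex.I * ((2 * Real.pi * x : ℝ) : ℂ) =
          ((v.arg + 2 * Real.pi * x : ℝ) : ℂ) * Complex.I by push_cast; ring,
        Complex.exp_ofReal_mul_I_re]
    rw [← h1, ← Complex.normSq_eq_norm_sq, Complex.normSq_add, Complex.normSq_eq_norm_sq,
      Complex.normSq_eq_norm_sq, norm_mul, norm_unitExp, mul_one]
    congr 2
    simp only [Complex.mul_re, Complex.conj_re, Complex.conj_im]
    ring
  rcases Set.eq_empty_or_nonempty {x : ℝ | ‖z + w * unitExp x‖ = c} with h | ⟨y, hy⟩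
  · rw [h]; exact Set.countable_empty
  refine ((Set.countable_range fun k : ℤ => y - k).union
    (Set.countable_range fun k : ℤ => (k - y - v.arg / Real.pi : ℝ))).mono ?_
  intro x hx
  have hcos : Real.cos (v.arg + 2 * Real.pi * x) = Real.cos (v.arg + 2 * Real.pi * y) := by
    have h1 := key x
    have h2 := key y
    rw [show ‖z + w * unitExp x‖ = c from hx] at h1
    rw [show ‖z + w * unitExp y‖ = c from hy] at h2
    exact mul_left_cancel₀ hv0 (by linarith)
  have hpi := Real.pi_pos
  obtain ⟨k, hk | hk⟩ := Real.cos_eq_cos_iff.1 hcos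
  · left
    refine ⟨k, mul_left_cancel₀ (by positivity : 2 * Real.pi ≠ 0) ?_⟩
    simp only
    linarith
  · right
    refine ⟨k, ?_⟩
    simp only
    field_simp
    linarith

lemma sum_harmonic_majorant_le {N : ℕ} (hlog : 1 ≤ Real.log N) {κ T : ℝ} (hκ : 0 < κ)
    (hT : T = N * Real.log N) :
    ∑ j ∈ Finset.range (N + 1), ((if j ≤ 3 then T else 0) + 2 * N / κ * (j : ℝ)⁻¹) ≤
      (4 + 4 / κ) * T := by
  have hT0 : 0 ≤ T := by rw [hT]; positivity
  have h1 : ∑ j ∈ Finset.range (N + 1), (if j ≤ 3 then T else 0) ≤ 4 * T := by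
    rw [← Finset.sum_filter, Finset.sum_const, nsmul_eq_mul]
    gcongr
    have : (Finset.range (N + 1)).filter (fun j => j ≤ 3) ⊆ Finset.range 4 := by
      intro j hj
      simp only [Finset.mem_filter, Finset.mem_range] at hj ⊢
      omega
    exact_mod_cast (Finset.card_le_card this).trans_eq (Finset.card_range 4)
  have h2 : ∑ j ∈ Finset.range (N + 1), (j : ℝ)⁻¹ ≤ 2 * Real.log N := by
    have h := harmonic_le_one_add_log N
    rw [Finset.sum_range_succ']
    have : ((harmonic N : ℚ) : ℝ) = ∑ i ∈ Finset.range N, ((i + 1 : ℕ) : ℝ)⁻¹ := by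
      simp [harmonic]
    rw [← this]
    simp only [Nat.cast_zero, inv_zero, add_zero]
    linarith
  rw [Finset.sum_add_distrib, ← Finset.mul_sum]
  have h3 : 2 * N / κ * ∑ j ∈ Finset.range (N + 1), (j : ℝ)⁻¹ ≤
      2 * N / κ * (2 * Real.log N) := by gcongr
  have h4 : 2 * N / κ * (2 * Real.log N) = 4 / κ * T := by rw [hT]; ring
  linarith

/-- Along `N` consecutive points of a rotation whose angle is very close to a reduced fraction of
denominator `N`, the reciprocal of the distance to the integers, truncated at height
`T = N log N`, sums to `O(T)`. -/
lemma sum_truncated_inv_nint_le {N : ℕ} (hlog : 1 ≤ Real.log N) {κ T C θ : ℝ} (hκ : 0 < κ)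
    (hT : T = N * Real.log N) (hC : C ≤ Real.log N) {p : ℤ} (hp : IsCoprime (N : ℤ) p)
    (hθ : |N * θ - p| ≤ C / T) (c : ℝ) :
    ∑ m ∈ Finset.range N, (max (κ * nint (θ * m + c)) (1 / T))⁻¹ ≤ (8 + 8 / κ) * T := by
  have hN0 : N ≠ 0 := by
    rintro rfl
    norm_num at hlog
  have hN : (0 : ℝ) < N := by positivity
  have hT0 : 0 < T := by rw [hT]; positivity
  set s : ℤ := ⌊c * N⌋ with hs
  set J : ℕ → ℕ := fun m => ((p * m + s) % N).toNat with hJ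
  set G : ℕ → ℝ := fun j => (if j ≤ 3 then T else 0) + 2 * N / κ * (j : ℝ)⁻¹ with hG
  have hG0 : ∀ j, 0 ≤ G j := fun j => by
    simp only [hG]
    split_ifs <;> positivity
  have hJcast : ∀ m, ((J m : ℕ) : ℤ) = (p * m + s) % N := fun m =>
    Int.toNat_of_nonneg (Int.emod_nonneg _ (by exact_mod_cast hN0))
  have hJlt : ∀ m, J m < N := fun m => by
    have := Int.emod_lt_of_pos (p * m + s) (by exact_mod_cast hN0.bot_lt : (0 : ℤ) < N)
    rw [← hJcast] at this
    exact_mod_cast this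
  have hinj : Set.InjOn J (Finset.range N : Set ℕ) := by
    intro m hm m' hm' h
    simp only [Finset.coe_range, Set.mem_Iio] at hm hm'
    have h1 : (p * m + s) % N = (p * m' + s) % N := by rw [← hJcast, ← hJcast, h]
    have h2 : (N : ℤ) ∣ p * (m' - m) := by
      have h3 := Int.ModEq.dvd (show (p * m + s) ≡ (p * m' + s) [ZMOD N] from h1)
      convert h3 using 1
      ring
    obtain ⟨k, hk⟩ := hp.dvd_of_dvd_mul_left h2
    have hk0 : k = 0 := by
      have hNz : (0 : ℤ) < N := by exact_mod_cast hN0.bot_lt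
      have h5 : (m : ℤ) < N := by exact_mod_cast hm
      have h6 : (m' : ℤ) < N := by exact_mod_cast hm'
      have : k < 1 := by nlinarith [Int.natCast_nonneg m]
      have : -1 < k := by nlinarith [Int.natCast_nonneg m']
      omega
    rw [hk0] at hk
    omega
  have hG1 : ∀ d : ℕ, ∀ y : ℝ, (d : ℝ) / N - 2 / N ≤ y → (max (κ * y) (1 / T))⁻¹ ≤ G d := by
    intro d y hy
    simp only [hG]
    split_ifs with hd
    · have h1 : (max (κ * y) (1 / T))⁻¹ ≤ T := by
        rw [inv_le_comm₀ (lt_max_of_lt_right (by positivity)) hT0, ← one_div]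
        exact le_max_right _ _
      have : 0 ≤ 2 * N / κ * (d : ℝ)⁻¹ := by positivity
      linarith
    · have hd4 : (4 : ℝ) ≤ d := by exact_mod_cast (by omega : 4 ≤ d)
      have h1 : (d : ℝ) / (2 * N) ≤ y := by
        refine le_trans ?_ hy
        rw [← sub_div, div_le_div_iff₀ (by positivity) hN]
        nlinarith
      rw [zero_add, show 2 * N / κ * (d : ℝ)⁻¹ = (κ * (d / (2 * N)))⁻¹ by
        field_simp]
      apply inv_anti₀ (by positivity)
      exact le_max_of_le_left (by gcongr)
  have hterm : ∀ m ∈ Finset.range N,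
      (max (κ * nint (θ * m + c)) (1 / T))⁻¹ ≤ G (J m) + G (N - J m) := by
    intro m hm
    have hmN : (m : ℝ) ≤ N := by exact_mod_cast (Finset.mem_range.1 hm).le
    set q : ℤ := (p * m + s) / N with hq
    have hdiv : (p * m + s : ℝ) = J m + N * q := by
      have := Int.emod_add_mul_ediv (p * m + s) N
      rw [← hJcast] at this
      exact_mod_cast this.symm
    have happrox : |θ * m + c - (J m / N + q)| ≤ 2 / N := by
      have e1 : |θ * m - p * m / N| ≤ 1 / N := by
        have : θ * m - p * m / N = m / N * (N * θ - p) := by field_simp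
        rw [this, abs_mul, abs_of_nonneg (by positivity)]
        have hCT : C / T ≤ 1 / N := by
          rw [hT, div_le_div_iff₀ (by positivity) hN]
          nlinarith
        calc (m : ℝ) / N * |N * θ - p| ≤ 1 * (1 / N) := by
              gcongr
              · rw [div_le_one hN]; exact hmN
              · exact hθ.trans hCT
          _ = 1 / N := one_mul _
      have e2 : |c - s / N| ≤ 1 / N := by
        have l1 := Int.floor_le (c * N)
        have l2 := Int.lt_floor_add_one (c * N)
        rw [← hs] at l1 l2
        have : c - s / N = (c * N - s) / N := by field_simp
        rw [this, abs_div, abs_of_pos hN, div_le_div_iff_of_pos_right hN, abs_le]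
        constructor <;> linarith
      have e3 : (J m : ℝ) / N + q = p * m / N + s / N := by
        field_simp
        linarith
      rw [e3, show θ * m + c - (p * m / N + s / N) = (θ * m - p * m / N) + (c - s / N) by ring]
      refine (abs_add_le _ _).trans ?_
      rw [show (2 : ℝ) / N = 1 / N + 1 / N by ring]
      linarith
    have hsub : ((N - J m : ℕ) : ℝ) = N - J m := by
      rw [Nat.cast_sub (hJlt m).le]
    have hJN : (J m : ℝ) < N := by exact_mod_cast hJlt m
    set k : ℤ := round (θ * m + c) - q with hk
    have hkc : (round (θ * m + c) : ℝ) = k + q := by rw [hk]; push_cast; ring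
    have hlow : |(J m : ℝ) / N - k| - 2 / N ≤ nint (θ * m + c) := by
      rw [nint, hkc]
      have := abs_sub_abs_le_abs_sub ((J m : ℝ) / N - k) ((J m / N + q) - (θ * m + c))
      rw [abs_sub_comm (J m / N + q : ℝ)] at this
      rw [show θ * m + c - (k + q) = (J m : ℝ) / N - k - ((J m / N + q) - (θ * m + c)) by ring]
      linarith
    rcases le_or_gt k 0 with hk0 | hk0
    · have hk0' : (k : ℝ) ≤ 0 := by exact_mod_cast hk0
      have := hG1 (J m) _ (le_trans (by
        have := le_abs_self ((J m : ℝ) / N - k)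
        linarith) hlow)
      linarith [hG0 (N - J m)]
    · have hk0' : (1 : ℝ) ≤ k := by exact_mod_cast hk0
      have := hG1 (N - J m) _ (le_trans (by
        have := neg_le_abs ((J m : ℝ) / N - k)
        rw [hsub, sub_div, div_self hN.ne']
        linarith) hlow)
      linarith [hG0 (J m)]
  have hsum := sum_harmonic_majorant_le hlog hκ hT
  have hperm : ∑ m ∈ Finset.range N, (G (J m) + G (N - J m)) ≤
      ∑ j ∈ Finset.range N, (G j + G (N - j)) := by
    rw [← Finset.sum_image (f := fun j => G j + G (N - j)) hinj]
    refine Finset.sum_le_sum_of_subset_of_nonneg ?_ fun j _ _ => add_nonneg (hG0 _) (hG0 _)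
    intro j hj
    obtain ⟨m, -, rfl⟩ := Finset.mem_image.1 hj
    exact Finset.mem_range.2 (hJlt m)
  have hs1 : ∑ j ∈ Finset.range N, G j ≤ ∑ j ∈ Finset.range (N + 1), G j := by
    rw [Finset.sum_range_succ]
    linarith [hG0 N]
  have hs2 : ∑ j ∈ Finset.range N, G (N - j) ≤ ∑ j ∈ Finset.range (N + 1), G j := by
    rw [← Finset.sum_range_reflect G (N + 1), Finset.sum_range_succ]
    have : ∀ j ∈ Finset.range N, G (N + 1 - 1 - j) = G (N - j) := fun j _ => rfl
    rw [Finset.sum_congr rfl this]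
    linarith [hG0 (N + 1 - 1 - N)]
  calc _ ≤ _ := Finset.sum_le_sum hterm
    _ ≤ _ := hperm
    _ ≤ (4 + 4 / κ) * T + (4 + 4 / κ) * T := by
      rw [Finset.sum_add_distrib]
      exact add_le_add (hs1.trans hsum) (hs2.trans hsum)
    _ = _ := by ring

lemma exists_reduced_approximation {θ : ℝ} (hθ : Irrational θ) {C : ℝ}
    (h : ∃ᶠ n : ℕ in atTop, (n : ℝ) * Real.log n * nint (n * θ) ≤ C) (N₀ : ℕ) :
    ∃ N : ℕ, N₀ ≤ N ∧ ∃ p : ℤ, IsCoprime (N : ℤ) p ∧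
      |N * θ - p| ≤ |C| / (N * Real.log N) := by
  have hpos : ∀ k : ℕ, k ≠ 0 → 0 < nint (k * θ) := by
    intro k hk
    refine abs_pos.2 (sub_ne_zero.2 ?_)
    exact (hθ.natCast_mul hk).ne_int _
  have hlim : Tendsto (fun n : ℕ => |C| / ((n : ℝ) * Real.log n)) atTop (nhds 0) := by
    refine Tendsto.div_atTop tendsto_const_nhds ?_
    exact tendsto_natCast_atTop_atTop.atTop_mul_atTop₀
      (Real.tendsto_log_atTop.comp tendsto_natCast_atTop_atTop)
  have hev : ∀ᶠ n : ℕ in atTop, ∀ k ∈ (Finset.range (N₀ + 2)), k ≠ 0 →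
      |C| / ((n : ℝ) * Real.log n) < nint (k * θ) := by
    rw [eventually_all_finset]
    intro k _
    rcases eq_or_ne k 0 with rfl | hk
    · simp
    · filter_upwards [hlim.eventually (gt_mem_nhds (hpos k hk))] with n hn _ using hn
  obtain ⟨n, hn, hnev, hn2⟩ := (h.and_eventually (hev.and (eventually_ge_atTop 3))).exists
  have hnr : (3 : ℝ) ≤ n := by exact_mod_cast hn2
  have hn0 : (n : ℤ) ≠ 0 := by exact_mod_cast (by omega : n ≠ 0)
  have hlogn : 0 < Real.log n := Real.log_pos (by linarith)
  set r : ℤ := round ((n : ℝ) * θ) with hr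
  set g : ℕ := Int.gcd n r with hg
  have hg0 : 0 < g := Int.gcd_pos_of_ne_zero_left _ hn0
  obtain ⟨N, hN⟩ : g ∣ n := Int.natCast_dvd_natCast.1 (Int.gcd_dvd_left _ _)
  obtain ⟨p, hp⟩ : (g : ℤ) ∣ r := Int.gcd_dvd_right _ _
  have hbound : |n * θ - r| ≤ |C| / (n * Real.log n) := by
    rw [le_div_iff₀ (by positivity)]
    have : |n * θ - r| * (n * Real.log n) = n * Real.log n * nint (n * θ) := by
      rw [nint, ← hr]; ring
    rw [this]
    exact hn.trans (le_abs_self C)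
  have hNpos : 0 < N := by
    rcases Nat.eq_zero_or_pos N with h0 | h0
    · rw [h0] at hN; omega
    · exact h0
  have hgr : (1 : ℝ) ≤ g := by exact_mod_cast hg0
  have hscale : |n * θ - r| = g * |N * θ - p| := by
    have h1 : (n : ℝ) = g * N := by exact_mod_cast hN
    have h2 : (r : ℝ) = g * p := by exact_mod_cast hp
    rw [h1, h2, show (g : ℝ) * N * θ - g * p = g * (N * θ - p) by ring, abs_mul,
      abs_of_pos (by linarith : (0 : ℝ) < g)]
  have hle : |N * θ - p| ≤ |C| / (n * Real.log n) := by
    refine le_trans ?_ hbound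
    rw [hscale]
    nlinarith [abs_nonneg (N * θ - p)]
  have hNbig : N₀ + 2 ≤ N := by
    by_contra hlt
    have h1 := hnev N (Finset.mem_range.2 (by omega)) hNpos.ne'
    have h2 : nint (N * θ) ≤ |N * θ - p| := round_le _ _
    linarith
  refine ⟨N, by omega, p, ?_, ?_⟩
  · have := Int.isCoprime_iff_gcd_eq_one.2 (Int.gcd_div_gcd_div_gcd (i := n) (j := r)
      (Int.gcd_pos_of_ne_zero_left _ hn0))
    have hgz : (g : ℤ) ≠ 0 := by exact_mod_cast hg0.ne'
    rw [← hg] at this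
    have e1 : (n : ℤ) / (g : ℤ) = N := by
      rw [show (n : ℤ) = g * N by exact_mod_cast hN]
      exact Int.mul_ediv_cancel_left _ hgz
    have e2 : r / (g : ℤ) = p := by
      rw [hp]
      exact Int.mul_ediv_cancel_left _ hgz
    rwa [e1, e2] at this
  · refine hle.trans ?_
    have hNr : (2 : ℝ) ≤ N := by exact_mod_cast (by omega : 2 ≤ N)
    have hNn : (N : ℝ) ≤ n := by
      exact_mod_cast Nat.le_of_dvd (by omega) ⟨g, by rw [hN, mul_comm]⟩
    have hlogN : 0 < Real.log N := Real.log_pos (by linarith)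
    have : Real.log N ≤ Real.log n := Real.log_le_log (by linarith) hNn
    gcongr

lemma lintegral_Ico_div_eq {a : ℝ} (ha : 0 < a) {h : ℝ → ENNReal} (hh : Measurable h) (L : ℕ) :
    ∫⁻ y in Set.Ico 0 (L / a), h y =
      ENNReal.ofReal (1 / a) *
        ∫⁻ r in Set.Ico (0 : ℝ) 1, ∑ m ∈ Finset.range L, h ((m + r) / a) := by
  induction L with
  | zero => simp
  | succ L ih =>
    have hsplit : Set.Ico (0 : ℝ) ((L + 1 : ℕ) / a) =
        Set.Ico 0 (L / a) ∪ Set.Ico (L / a) ((L + 1 : ℕ) / a) := by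
      rw [Set.Ico_union_Ico_eq_Ico (by positivity)]
      push_cast
      gcongr
      linarith
    have himage : (fun r : ℝ => (L + r) / a) '' Set.Ico 0 1 =
        Set.Ico (L / a) ((L + 1 : ℕ) / a) := by
      ext y
      simp only [Set.mem_image, Set.mem_Ico, Nat.cast_add, Nat.cast_one]
      constructor
      · rintro ⟨r, ⟨h0, h1⟩, rfl⟩
        constructor <;> gcongr
        linarith
      · rintro ⟨h0, h1⟩
        rw [div_le_iff₀ ha] at h0
        rw [lt_div_iff₀ ha] at h1
        exact ⟨y * a - L, ⟨by linarith, by linarith⟩, by field_simp; ring⟩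
    have hlast : ∫⁻ y in Set.Ico (L / a) ((L + 1 : ℕ) / a), h y =
        ENNReal.ofReal (1 / a) * ∫⁻ r in Set.Ico (0 : ℝ) 1, h ((L + r) / a) := by
      rw [← himage, lintegral_image_eq_lintegral_abs_deriv_mul (f' := fun _ => 1 / a)
        measurableSet_Ico, abs_of_pos (by positivity), lintegral_const_mul]
      · fun_prop
      · intro x _
        exact (((hasDerivAt_id x).const_add (L : ℝ)).div_const a).hasDerivWithinAt
      · intro x _ y _ hxy
        simp only at hxy
        field_simp at hxy
        linarith
    rw [hsplit, lintegral_union measurableSet_Ico, ih, hlast, ← mul_add, ← lintegral_add_right]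
    · simp_rw [Finset.sum_range_succ]
    · fun_prop
    · rw [Set.disjoint_left]
      intro y hy hy'
      exact absurd hy.2 (not_lt.2 hy'.1)

lemma lintegral_sum_shift_le {a : ℝ} (ha : 0 < a) {h : ℝ → ENNReal} (hh : Measurable h)
    {M L : ℕ} (hML : (M : ℝ) ≤ L / a) :
    ∫⁻ x in Set.Ico (0 : ℝ) 1, ∑ k ∈ Finset.range M, h (x + k) ≤
      ENNReal.ofReal (1 / a) *
        ∫⁻ r in Set.Ico (0 : ℝ) 1, ∑ m ∈ Finset.range L, h ((m + r) / a) := by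
  rw [← lintegral_Ico_div_eq ha hh]
  have h1 := lintegral_Ico_div_eq one_pos hh M
  simp only [div_one, ENNReal.ofReal_one, one_mul] at h1
  simp_rw [add_comm _ ((_ : ℕ) : ℝ)]
  rw [← h1]
  exact lintegral_mono_set (Set.Ico_subset_Ico_right hML)

/-- The trigonometric trinomial `C₀ + C₁ e^{2πiαx} + C₂ e^{2πiβx}`. -/
noncomputable def trinomial (C₀ C₁ C₂ : ℂ) (α β x : ℝ) : ℂ :=
  C₀ + C₁ * unitExp (α * x) + C₂ * unitExp (β * x)

@[fun_prop]
lemma continuous_trinomial (C₀ C₁ C₂ : ℂ) (α β : ℝ) : Continuous (trinomial C₀ C₁ C₂ α β) := by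
  unfold trinomial
  fun_prop

lemma trinomial_natCast_add_div (C₀ C₁ C₂ : ℂ) {α : ℝ} (hα : α ≠ 0) (β : ℝ) (m : ℕ) (r : ℝ) :
    trinomial C₀ C₁ C₂ α β ((m + r) / |α|) =
      (C₀ + C₁ * unitExp (α / |α| * r)) + C₂ * unitExp (β / |α| * m + β / |α| * r) := by
  have ha : 0 < |α| := abs_pos.2 hα
  have h1 : unitExp (α * ((m + r) / |α|)) = unitExp (α / |α| * r) := by
    rcases abs_choice α with h | h
    · rw [← unitExp_add_int (α / |α| * r) m]
      congr 1
      rw [h]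
      field_simp
      push_cast
      ring
    · rw [← unitExp_add_int (α / |α| * r) (-m)]
      congr 1
      rw [h]
      field_simp
      push_cast
      ring
  rw [trinomial, h1]
  congr 3
  ring

lemma countable_trinomial_eq_zero {C₀ C₁ C₂ : ℂ} (h₀ : C₀ ≠ 0) (h₁ : C₁ ≠ 0) {α : ℝ}
    (hα : α ≠ 0) (β : ℝ) : {x | trinomial C₀ C₁ C₂ α β x = 0}.Countable := by
  have h := (countable_norm_add_mul_unitExp_eq h₀ h₁ ‖C₂‖).preimage
    (mul_right_injective₀ hα)
  refine h.mono fun x hx => ?_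
  have hx' : C₀ + C₁ * unitExp (α * x) = -(C₂ * unitExp (β * x)) :=
    eq_neg_of_add_eq_zero_left hx
  simp only [Set.mem_preimage, Set.mem_ofPred_eq]
  rw [hx', norm_neg, norm_mul, norm_unitExp, mul_one]

lemma sum_truncated_inv_trinomial_le {C₀ C₁ C₂ : ℂ} (h₂ : C₂ ≠ 0) {α β : ℝ} (hα : α ≠ 0)
    {N : ℕ} (hlog : 1 ≤ Real.log N) {T C : ℝ}
    (hT : T = N * Real.log N) (hC : C ≤ Real.log N) {p : ℤ} (hp : IsCoprime (N : ℤ) p)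
    (hθ : |N * (β / |α|) - p| ≤ C / T) (b : ℕ) (r : ℝ) :
    ∑ m ∈ Finset.range (b * N), (max ‖trinomial C₀ C₁ C₂ α β ((m + r) / |α|)‖ (1 / T))⁻¹ ≤
      b * (8 + 8 / (2 * ‖C₂‖)) * T := by
  have hN0 : N ≠ 0 := by
    rintro rfl
    norm_num at hlog
  have hT0 : 0 < T := by rw [hT]; positivity
  have hκ : 0 < 2 * ‖C₂‖ := by positivity
  obtain ⟨c, hc⟩ := exists_two_mul_nint_le_norm_add (C₀ + C₁ * unitExp (α / |α| * r)) C₂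
  induction b with
  | zero => simp
  | succ b ih =>
    rw [Nat.succ_mul, Finset.sum_range_add]
    have hblock := sum_truncated_inv_nint_le hlog hκ hT hC hp hθ
      (β / |α| * (b * N) + β / |α| * r + c)
    have hle : ∀ m ∈ Finset.range N,
        (max ‖trinomial C₀ C₁ C₂ α β (((b * N + m : ℕ) + r) / |α|)‖ (1 / T))⁻¹ ≤
        (max (2 * ‖C₂‖ *
          nint (β / |α| * m + (β / |α| * (b * N) + β / |α| * r + c))) (1 / T))⁻¹ := by
      intro m _
      apply inv_anti₀ (lt_max_of_lt_right (by positivity))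
      gcongr
      rw [trinomial_natCast_add_div _ _ _ hα]
      refine le_trans (le_of_eq ?_) (hc _)
      congr 2
      push_cast
      ring
    have := Finset.sum_le_sum hle
    push_cast at this ⊢
    nlinarith

lemma exists_measure_norm_near_lt {z w : ℂ} (hz : z ≠ 0) (hw : w ≠ 0) {σ : ℝ} (hσ : σ ≠ 0)
    (c : ℝ) {δ : ℝ} (hδ : 0 < δ) :
    ∃ T₀ : ℝ, ∀ T, T₀ ≤ T →
      volume ({r : ℝ | |‖z + w * unitExp (σ * r)‖ - c| < 1 / T} ∩ Set.Ico 0 1) ≤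
        ENNReal.ofReal δ := by
  set s : ℕ → Set ℝ := fun n =>
    {r : ℝ | |‖z + w * unitExp (σ * r)‖ - c| < 1 / (n + 1)} ∩ Set.Ico 0 1 with hs
  have hmeas : ∀ n, NullMeasurableSet (s n) volume := fun n =>
    ((isOpen_lt (by fun_prop) continuous_const).measurableSet.inter
      measurableSet_Ico).nullMeasurableSet
  have hanti : Antitone s := by
    intro m n hmn
    refine Set.inter_subset_inter_left _ fun r hr => ?_
    rw [Set.mem_ofPred_eq] at hr ⊢
    refine lt_of_lt_of_le hr ?_
    have : (m : ℝ) ≤ n := by exact_mod_cast hmn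
    gcongr
  have hfin : ∃ n, volume (s n) ≠ ⊤ :=
    ⟨0, ((measure_mono Set.inter_subset_right).trans_lt (by simp)).ne⟩
  have hlim := tendsto_measure_iInter_atTop hmeas hanti hfin
  have hzero : volume (⋂ n, s n) = 0 := by
    refine Set.Countable.measure_zero (Set.Countable.mono ?_
      ((countable_norm_add_mul_unitExp_eq hz hw c).preimage (mul_right_injective₀ hσ))) _
    intro r hr
    rw [Set.mem_iInter] at hr
    have h0 : |‖z + w * unitExp (σ * r)‖ - c| ≤ 0 :=
      ge_of_tendsto' tendsto_one_div_add_atTop_nhds_zero_nat fun n => (hr n).1.le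
    exact sub_eq_zero.1 (abs_nonpos_iff.1 h0)
  rw [hzero] at hlim
  obtain ⟨n, hn⟩ := (hlim.eventually (gt_mem_nhds (ENNReal.ofReal_pos.2 hδ))).exists
  refine ⟨n + 1, fun T hT => le_trans (measure_mono ?_) hn.le⟩
  refine Set.inter_subset_inter_left _ fun r hr => ?_
  rw [Set.mem_ofPred_eq] at hr ⊢
  refine lt_of_lt_of_le hr ?_
  gcongr

/-- Outside a set of small measure, the reciprocals of the trinomial along an orbit segment of
length `O(N)` sum to `O(N log N)`. -/
lemma exists_measure_sum_inv_trinomial_gt_le {C₀ C₁ C₂ : ℂ} (h₀ : C₀ ≠ 0) (h₁ : C₁ ≠ 0)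
    (h₂ : C₂ ≠ 0) {α : ℝ} (β : ℝ) (hα : α ≠ 0) (C : ℝ) (b : ℕ) {δ : ℝ} (hδ : 0 < δ) :
    ∃ A > 0, ∃ T₀ : ℝ, ∀ (N : ℕ) (p : ℤ) (T : ℝ), 1 ≤ Real.log N → C ≤ Real.log N →
      T = N * Real.log N → T₀ ≤ T → IsCoprime (N : ℤ) p → |N * (β / |α|) - p| ≤ C / T →
      ∀ M : ℕ, (M : ℝ) ≤ (b * N : ℕ) / |α| →
        volume (Set.Ico (0 : ℝ) 1 \ {x | (∀ k < M, trinomial C₀ C₁ C₂ α β (x + k) ≠ 0) ∧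
          ∑ k ∈ Finset.range M, ‖trinomial C₀ C₁ C₂ α β (x + k)‖⁻¹ ≤ A * T}) ≤
            ENNReal.ofReal δ := by
  set a := |α| with ha'
  have ha : 0 < a := abs_pos.2 hα
  set K : ℝ := (b + 1) * (8 + 8 / (2 * ‖C₂‖)) with hK
  have hK0 : 0 < K := by positivity
  obtain ⟨T₀, hT₀⟩ := exists_measure_norm_near_lt h₀ h₁
    (σ := α / a) (div_ne_zero hα ha.ne') ‖C₂‖ (δ := δ / 2 * a / K) (by positivity)
  refine ⟨K / (a * (δ / 2)), by positivity, T₀, ?_⟩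
  intro N p T hlog hC hT hTT₀ hp hθ M hM
  have hN0 : N ≠ 0 := by
    rintro rfl
    norm_num at hlog
  have hT0 : 0 < T := by rw [hT]; positivity
  set P := trinomial C₀ C₁ C₂ α β with hP
  have hPc : Continuous P := continuous_trinomial ..
  set W : ℝ → ℝ := fun y => (max ‖P y‖ (1 / T))⁻¹ with hW
  have hmax : ∀ y, 0 < max ‖P y‖ (1 / T) := fun y => lt_max_of_lt_right (by positivity)
  have hW0 : ∀ y, 0 < W y := fun y => inv_pos.2 (hmax y)
  have hWc : Continuous W := Continuous.inv₀ (by fun_prop) fun y => (hmax y).ne'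
  have hWsum : ∀ r, ∑ m ∈ Finset.range (b * N), W ((m + r) / a) ≤ K * T := by
    intro r
    refine (sum_truncated_inv_trinomial_le h₂ hα hlog hT hC hp hθ b r).trans ?_
    rw [hK]
    gcongr
    linarith
  set A := K / (a * (δ / 2)) with hA
  set B₁ : Set ℝ := {x | ∃ k < M, ‖P (x + k)‖ < 1 / T} with hB₁
  set B₂ : Set ℝ := {x | A * T ≤ ∑ k ∈ Finset.range M, W (x + k)} with hB₂
  have hsub : Set.Ico (0 : ℝ) 1 \ {x | (∀ k < M, P (x + k) ≠ 0) ∧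
      ∑ k ∈ Finset.range M, ‖P (x + k)‖⁻¹ ≤ A * T} ⊆
      (B₁ ∩ Set.Ico 0 1) ∪ (B₂ ∩ Set.Ico 0 1) := by
    rintro x ⟨hx, hx'⟩
    by_contra hcon
    simp only [Set.mem_union, Set.mem_inter_iff, hx, and_true, not_or] at hcon
    obtain ⟨hn1, hn2⟩ := hcon
    have hge : ∀ k < M, 1 / T ≤ ‖P (x + k)‖ := by
      intro k hk
      by_contra hlt
      exact hn1 ⟨k, hk, not_le.1 hlt⟩
    refine hx' ⟨fun k hk h0 => ?_, ?_⟩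
    · have := hge k hk
      rw [h0, norm_zero] at this
      exact absurd this (not_le.2 (by positivity))
    · refine le_trans (Finset.sum_le_sum fun k hk => ?_) (not_le.1 hn2).le
      simp only [hW]
      rw [max_eq_left (hge k (Finset.mem_range.1 hk))]
  have hB₁le : volume (B₁ ∩ Set.Ico 0 1) ≤ ENNReal.ofReal (δ / 2) := by
    set h : ℝ → ENNReal := {y | ‖P y‖ < 1 / T}.indicator 1 with hh
    have hhm : Measurable h :=
      measurable_one.indicator (isOpen_lt (by fun_prop) continuous_const).measurableSet
    have hhle : ∀ y, h y ≤ ENNReal.ofReal (W y / T) := by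
      intro y
      rw [hh, Set.indicator_apply]
      split_ifs with hy
      · have : W y / T = 1 := by
          simp only [hW]
          rw [max_eq_right (le_of_lt hy)]
          field_simp
        simp [this]
      · exact zero_le
    set Q : Set ℝ := {r : ℝ | |‖C₀ + C₁ * unitExp (α / a * r)‖ - ‖C₂‖| < 1 / T} with hQ
    have hQm : MeasurableSet Q := (isOpen_lt (by fun_prop) continuous_const).measurableSet
    have hsum : ∀ r, ∑ m ∈ Finset.range (b * N), h ((m + r) / a) ≤
        Q.indicator (fun _ => ENNReal.ofReal K) r := by
      intro r
      rw [Set.indicator_apply]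
      split_ifs with hr
      · refine (Finset.sum_le_sum fun m _ => hhle _).trans ?_
        rw [← ENNReal.ofReal_sum_of_nonneg fun m _ => div_nonneg (hW0 _).le hT0.le,
          ← Finset.sum_div]
        apply ENNReal.ofReal_le_ofReal
        rw [div_le_iff₀ hT0]
        exact hWsum r
      · refine (Finset.sum_eq_zero fun m _ => ?_).le
        rw [hh, Set.indicator_of_notMem]
        intro hm
        rw [Set.mem_ofPred_eq] at hm
        rw [hQ, Set.mem_ofPred_eq] at hr
        refine hr (lt_of_le_of_lt ?_ hm)
        simp only [hP]
        rw [trinomial_natCast_add_div _ _ _ hα]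
        have := abs_norm_sub_norm_le (C₀ + C₁ * unitExp (α / a * r))
          (-(C₂ * unitExp (β / a * m + β / a * r)))
        rwa [norm_neg, norm_mul, norm_unitExp, mul_one, sub_neg_eq_add] at this
    calc volume (B₁ ∩ Set.Ico 0 1)
        = ∫⁻ x in Set.Ico (0 : ℝ) 1, B₁.indicator 1 x := by
          rw [lintegral_indicator_one, Measure.restrict_apply₀']
          · exact measurableSet_Ico.nullMeasurableSet
          · have : B₁ = ⋃ k ∈ Finset.range M, {x | ‖P (x + (k : ℕ))‖ < 1 / T} := by
              ext x; simp [hB₁]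
            rw [this]
            exact Finset.measurableSet_biUnion _ fun k _ =>
              (isOpen_lt (by fun_prop) continuous_const).measurableSet
      _ ≤ ∫⁻ x in Set.Ico (0 : ℝ) 1, ∑ k ∈ Finset.range M, h (x + k) := by
          refine lintegral_mono fun x => ?_
          rw [Set.indicator_apply]
          split_ifs with hx
          · obtain ⟨k, hk, hkP⟩ := hx
            refine le_trans ?_ (Finset.single_le_sum (f := fun k : ℕ => h (x + k))
              (fun _ _ => zero_le) (Finset.mem_range.2 hk))
            simp only [hh]
            rw [Set.indicator_of_mem (by exact hkP)]
            rfl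
          · exact zero_le
      _ ≤ ENNReal.ofReal (1 / a) *
            ∫⁻ r in Set.Ico (0 : ℝ) 1, ∑ m ∈ Finset.range (b * N), h ((m + r) / a) :=
          lintegral_sum_shift_le ha hhm hM
      _ ≤ ENNReal.ofReal (1 / a) *
            ∫⁻ r in Set.Ico (0 : ℝ) 1, Q.indicator (fun _ => ENNReal.ofReal K) r := by
          gcongr with r
          exact hsum r
      _ ≤ ENNReal.ofReal (1 / a) *
            (ENNReal.ofReal K * ENNReal.ofReal (δ / 2 * a / K)) := by
          rw [lintegral_indicator_const hQm, Measure.restrict_apply hQm]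
          gcongr
          exact hT₀ T hTT₀
      _ = ENNReal.ofReal (δ / 2) := by
          rw [← ENNReal.ofReal_mul hK0.le, ← ENNReal.ofReal_mul (by positivity)]
          congr 1
          field_simp
  have hB₂le : volume (B₂ ∩ Set.Ico 0 1) ≤ ENNReal.ofReal (δ / 2) := by
    set h : ℝ → ENNReal := fun y => ENNReal.ofReal (W y) with hh
    have hhm : Measurable h := by fun_prop
    have hofsum : ∀ (s : Finset ℕ) (g : ℕ → ℝ),
        ∑ k ∈ s, h (g k) = ENNReal.ofReal (∑ k ∈ s, W (g k)) := fun s g =>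
      (ENNReal.ofReal_sum_of_nonneg fun k _ => (hW0 _).le).symm
    have hAT : 0 < A * T := by positivity
    have hmarkov := mul_meas_ge_le_lintegral (μ := volume.restrict (Set.Ico (0 : ℝ) 1))
      (f := fun x => ∑ k ∈ Finset.range M, h (x + k)) (by fun_prop) (ENNReal.ofReal (A * T))
    have hset : {x | ENNReal.ofReal (A * T) ≤ ∑ k ∈ Finset.range M, h (x + k)} = B₂ := by
      ext x
      simp only [hofsum, Set.mem_ofPred_eq, hB₂]
      exact ENNReal.ofReal_le_ofReal_iff (Finset.sum_nonneg fun k _ => (hW0 _).le)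
    rw [hset, Measure.restrict_apply₀' measurableSet_Ico.nullMeasurableSet] at hmarkov
    have hupper : ∫⁻ x in Set.Ico (0 : ℝ) 1, ∑ k ∈ Finset.range M, h (x + k) ≤
        ENNReal.ofReal (A * T) * ENNReal.ofReal (δ / 2) := by
      calc _ ≤ _ := lintegral_sum_shift_le ha hhm hM
        _ ≤ ENNReal.ofReal (1 / a) * ∫⁻ _ in Set.Ico (0 : ℝ) 1, ENNReal.ofReal (K * T) := by
          gcongr with r
          rw [hofsum]
          exact ENNReal.ofReal_le_ofReal (hWsum r)
        _ = _ := by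
          simp only [lintegral_const, MeasurableSet.univ, Measure.restrict_apply, Set.univ_inter,
            Real.volume_Ico, sub_zero, ENNReal.ofReal_one, mul_one]
          rw [← ENNReal.ofReal_mul (by positivity), ← ENNReal.ofReal_mul hAT.le, hA]
          congr 1
          field_simp
    exact (ENNReal.mul_le_mul_iff_right (ENNReal.ofReal_pos.2 hAT).ne' ENNReal.ofReal_ne_top).1
      (hmarkov.trans hupper)
  calc _ ≤ _ := measure_mono hsub
    _ ≤ _ := measure_union_le _ _
    _ ≤ ENNReal.ofReal (δ / 2) + ENNReal.ofReal (δ / 2) := add_le_add hB₁le hB₂le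
    _ = ENNReal.ofReal δ := by
      rw [← ENNReal.ofReal_add (by positivity) (by positivity), add_halves]

lemma norm_trinomial_sub_le (C₀ C₁ C₂ : ℂ) {α : ℝ} (hα : α ≠ 0) (β : ℝ) (l N : ℕ) (p : ℤ)
    (y : ℝ) :
    ‖trinomial C₀ C₁ C₂ α β (y - l * (N / |α|)) - trinomial C₀ C₁ C₂ α β y‖ ≤
      ‖C₂‖ * (2 * Real.pi * (l * |N * (β / |α|) - p|)) := by
  have h1 : unitExp (α * (y - l * (N / |α|))) = unitExp (α * y) := by
    rcases abs_choice α with h | h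
    · rw [← unitExp_add_int (α * (y - l * (N / |α|))) ((l * N : ℕ) : ℤ)]
      congr 1
      rw [h]
      field_simp
      push_cast
      ring
    · rw [← unitExp_add_int (α * (y - l * (N / |α|))) (-((l * N : ℕ) : ℤ))]
      congr 1
      rw [h]
      field_simp
      push_cast
      ring
  have h2 : unitExp (β * (y - l * (N / |α|))) =
      unitExp (β * y) * unitExp (-(l * (N * (β / |α|)))) := by
    rw [← unitExp_add]
    congr 1
    ring
  rw [trinomial, trinomial, h1, h2, show C₀ + C₁ * unitExp (α * y) +
      C₂ * (unitExp (β * y) * unitExp (-(l * (N * (β / |α|))))) -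
      (C₀ + C₁ * unitExp (α * y) + C₂ * unitExp (β * y)) =
      C₂ * (unitExp (β * y) * (unitExp (-(l * (N * (β / |α|)))) - 1)) by ring,
    norm_mul, norm_mul, norm_unitExp, one_mul]
  gcongr
  refine (norm_unitExp_sub_one_le _ (-(l * p))).trans_eq ?_
  push_cast
  rw [show -(l * (N * (β / |α|))) - -((l : ℝ) * p) = -(l * (N * (β / |α|) - p)) by ring, abs_neg,
    abs_mul, Nat.abs_cast]

lemma prod_norm_le_prod_norm_mul_exp {n : ℕ} {g h : ℕ → ℂ} {η : ℝ} (hg : ∀ k < n, g k ≠ 0)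
    (hgh : ∀ k < n, ‖h k - g k‖ ≤ η) :
    ∏ k ∈ Finset.range n, ‖h k‖ ≤
      (∏ k ∈ Finset.range n, ‖g k‖) * Real.exp (η * ∑ k ∈ Finset.range n, ‖g k‖⁻¹) := by
  rw [Finset.mul_sum, Real.exp_sum, ← Finset.prod_mul_distrib]
  refine Finset.prod_le_prod (fun _ _ => norm_nonneg _) fun k hk => ?_
  have hk' := Finset.mem_range.1 hk
  have hpos : 0 < ‖g k‖ := norm_pos_iff.2 (hg k hk')
  have h1 : ‖h k‖ ≤ ‖g k‖ + η := by
    have := norm_le_norm_add_norm_sub' (h k) (g k)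
    linarith [hgh k hk']
  calc ‖h k‖ ≤ ‖g k‖ + η := h1
    _ = ‖g k‖ * (η * ‖g k‖⁻¹ + 1) := by field_simp; ring
    _ ≤ _ := by
      gcongr
      exact Real.add_one_le_exp _

/-- Among sufficiently many translates of a set of positive measure by multiples of `t`, two meet
modulo `1`. -/
lemma exists_translates_meet {D : Set ℝ} (hD : MeasurableSet D) (hD1 : D ⊆ Set.Ico 0 1) {J : ℕ}
    (hJ : 2 < ((J + 1 : ℕ) : ENNReal) * volume D) (t : ℝ) :
    ∃ d ∈ D, ∃ d' ∈ D, ∃ l : ℕ, 1 ≤ l ∧ l ≤ J ∧ ∃ n : ℤ, d = d' - l * t + n := by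
  set S : ℕ → Set ℝ := fun j => (fun y => y + -(Int.fract (j * t))) ⁻¹' D with hS
  have hSm : ∀ j, MeasurableSet (S j) := fun j => hD.preimage (by fun_prop)
  have hSsub : ∀ j, S j ⊆ Set.Ico 0 2 := by
    intro j y hy
    have h1 := hD1 hy
    have h2 := Int.fract_nonneg (j * t)
    have h3 := Int.fract_lt_one (j * t)
    exact ⟨by linarith [h1.1], by linarith [h1.2]⟩
  have hSvol : ∀ j, volume.restrict (Set.Ico (0 : ℝ) 2) (S j) = volume D := by
    intro j
    rw [Measure.restrict_apply (hSm j), Set.inter_eq_left.2 (hSsub j)]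
    exact measure_preimage_add_right volume _ D
  obtain ⟨i, hi, j, hj, hij, y, hyi, hyj⟩ := exists_nonempty_inter_of_measure_univ_lt_sum_measure
    (volume.restrict (Set.Ico (0 : ℝ) 2)) (s := Finset.range (J + 1)) (t := S)
    (fun j _ => (hSm j).nullMeasurableSet) (by
      simp only [hSvol, Finset.sum_const, Finset.card_range, nsmul_eq_mul]
      simpa using hJ)
  have aux : ∀ i j : ℕ, i < j → j ≤ J → y ∈ S i → y ∈ S j →
      ∃ d ∈ D, ∃ d' ∈ D, ∃ l : ℕ, 1 ≤ l ∧ l ≤ J ∧ ∃ n : ℤ, d = d' - l * t + n := by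
    intro i j hij hj hyi hyj
    refine ⟨_, hyj, _, hyi, j - i, by omega, by omega, ⌊j * t⌋ - ⌊i * t⌋, ?_⟩
    rw [← Int.self_sub_floor, ← Int.self_sub_floor, Nat.cast_sub hij.le]
    push_cast
    ring
  rw [Finset.mem_range] at hi hj
  rcases lt_or_gt_of_ne hij with h | h
  · exact aux i j h (by omega) hyi hyj
  · exact aux j i h (by omega) hyj hyi

lemma eq_mul_prod_of_shift_eq {f P : ℝ → ℂ} {x : ℝ}
    (h : ∀ k : ℤ, f (x + k + 1) = f (x + k) * P (x + k)) (m : ℤ) (n : ℕ) :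
    f (x + m + n) = f (x + m) * ∏ k ∈ Finset.range n, P (x + m + k) := by
  induction n with
  | zero => simp
  | succ n ih =>
    have := h (m + n)
    push_cast at this
    rw [Finset.prod_range_succ, ← mul_assoc, ← ih]
    push_cast
    simpa only [add_assoc] using this

lemma ae_forall_int_shift {q : ℝ → Prop} (hq : ∀ᵐ x, q x) : ∀ᵐ x, ∀ k : ℤ, q (x + k) := by
  rw [ae_all_iff]
  exact fun k => (quasiMeasurePreserving_add_right volume (k : ℝ)).ae hq

/-- A solution of the recurrence that vanishes on one period vanishes everywhere. -/
lemma ae_eq_zero_of_ae_eq_zero_on_period {f P : ℝ → ℂ}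
    (hrec : ∀ᵐ x : ℝ, ∀ k : ℤ, f (x + k + 1) = f (x + k) * P (x + k))
    (hP : ∀ᵐ x : ℝ, ∀ k : ℤ, P (x + k) ≠ 0)
    (hE0 : volume ({x | f x ≠ 0} ∩ Set.Ico 0 1) = 0) : f =ᵐ[volume] 0 := by
  have h1 : ∀ᵐ x, x ∉ {x | f x ≠ 0} ∩ Set.Ico 0 1 := measure_eq_zero_iff_ae_notMem.1 hE0
  filter_upwards [ae_forall_int_shift h1, hrec, hP] with x hx hxr hxP
  by_contra hne
  have hmem : x + (-⌊x⌋ : ℤ) ∈ Set.Ico (0 : ℝ) 1 := by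
    push_cast
    rw [← sub_eq_add_neg, Int.self_sub_floor]
    exact ⟨Int.fract_nonneg _, Int.fract_lt_one _⟩
  have hz : f (x + (-⌊x⌋ : ℤ)) = 0 := by
    by_contra h
    exact hx (-⌊x⌋) ⟨h, hmem⟩
  rcases le_total 0 (-⌊x⌋) with hs | hs
  · obtain ⟨n, hn⟩ := Int.eq_ofNat_of_zero_le hs
    have := eq_mul_prod_of_shift_eq hxr 0 n
    rw [hn] at hz
    simp only [Int.cast_zero, add_zero, Int.cast_natCast] at this hz
    rw [hz] at this
    rcases mul_eq_zero.1 this.symm with h | h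
    · exact hne h
    · obtain ⟨k, -, hk⟩ := Finset.prod_eq_zero_iff.1 h
      exact hxP k (by simpa using hk)
  · obtain ⟨n, hn⟩ := Int.eq_ofNat_of_zero_le (neg_nonneg.2 hs)
    have := eq_mul_prod_of_shift_eq hxr (-⌊x⌋) n
    rw [hz, zero_mul] at this
    apply hne
    rw [neg_neg] at hn
    rw [hn] at this
    simpa using this

/-- On most of the part of a period where a decaying solution of the recurrence does not vanish,
the forward products are uniformly small and the backward products are uniformly large. -/
lemma exists_set_prod_norm_le {f P : ℝ → ℂ} (hf : Measurable f) (hPc : Continuous P)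
    (hrec : ∀ᵐ x : ℝ, ∀ k : ℤ, f (x + k + 1) = f (x + k) * P (x + k))
    (hdecay : ∀ᵐ x ∂(volume.restrict (Set.Ico (0 : ℝ) 1)),
      Tendsto (fun n : ℤ => f (x + n)) cofinite (nhds 0))
    {ε : ℝ} (hε0 : 0 < ε) {δ : ENNReal} (hδE : δ < volume ({x | f x ≠ 0} ∩ Set.Ico 0 1)) :
    ∃ n₀ : ℕ, ∃ U : Set ℝ, MeasurableSet U ∧ U ⊆ Set.Ico 0 1 ∧ δ < volume U ∧
      ∀ x ∈ U, ∀ n ≥ n₀, ∏ k ∈ Finset.range n, ‖P (x + k)‖ ≤ ε ∧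
        1 / ε ≤ ∏ k ∈ Finset.range n, ‖P (x - n + k)‖ := by
  set E : Set ℝ := {x | f x ≠ 0} ∩ Set.Ico 0 1 with hE
  have hEm : MeasurableSet E := (hf (measurableSet_singleton 0).compl).inter measurableSet_Ico
  set F : ℕ → ℝ → ℝ := fun n x => ∏ k ∈ Finset.range n, ‖P (x + k)‖ with hF
  set B : ℕ → ℝ → ℝ := fun n x => ∏ k ∈ Finset.range n, ‖P (x - n + k)‖ with hB
  have hFc : ∀ n, Continuous (F n) := fun n => by fun_prop
  have hBc : ∀ n, Continuous (B n) := fun n => by fun_prop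
  set U : ℕ → Set ℝ := fun n₀ => E ∩ ⋂ n ≥ n₀, {x | F n x ≤ ε} ∩ {x | 1 / ε ≤ B n x} with hU
  have hUm : ∀ n₀, MeasurableSet (U n₀) := fun n₀ =>
    hEm.inter (MeasurableSet.iInter fun n => MeasurableSet.iInter fun _ =>
      (isClosed_le (hFc n) continuous_const).measurableSet.inter
        (isClosed_le continuous_const (hBc n)).measurableSet)
  have hUmono : Monotone U := by
    intro i j hij
    refine Set.inter_subset_inter_right _ fun x hx => ?_
    simp only [Set.mem_iInter] at hx ⊢
    exact fun n hn => hx n (le_trans hij hn)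
  have hEU : volume E ≤ volume (⋃ n, U n) := by
    refine measure_mono_ae ?_
    filter_upwards [hrec, (ae_restrict_iff' measurableSet_Ico).1 hdecay]
      with x hxr hxd hxE
    have hlim := hxd hxE.2
    have hfx : 0 < ‖f x‖ := norm_pos_iff.2 hxE.1
    have hp : Tendsto (fun n : ℕ => ‖f (x + n)‖) atTop (nhds 0) := by
      have := (hlim.comp ((Nat.cast_injective (R := ℤ)).tendsto_cofinite)).norm
      rw [Nat.cofinite_eq_atTop, norm_zero] at this
      simpa [Function.comp_def] using this
    have hm : Tendsto (fun n : ℕ => ‖f (x - n)‖) atTop (nhds 0) := by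
      have := (hlim.comp ((neg_injective.comp (Nat.cast_injective (R := ℤ))).tendsto_cofinite)).norm
      rw [Nat.cofinite_eq_atTop, norm_zero] at this
      simpa [Function.comp_def, sub_eq_add_neg] using this
    have hεf : 0 < ε * ‖f x‖ := by positivity
    obtain ⟨n₀, hn₀⟩ := eventually_atTop.1
      ((hp.eventually (gt_mem_nhds hεf)).and (hm.eventually (gt_mem_nhds hεf)))
    refine Set.mem_iUnion.2 ⟨n₀, hxE, ?_⟩
    simp only [Set.mem_iInter]
    intro n hn
    obtain ⟨hn1, hn2⟩ := hn₀ n hn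
    constructor
    · have h := eq_mul_prod_of_shift_eq hxr 0 n
      simp only [Int.cast_zero, add_zero] at h
      rw [h, norm_mul, norm_prod, mul_comm] at hn1
      exact (lt_of_mul_lt_mul_right hn1 hfx.le).le
    · have h := eq_mul_prod_of_shift_eq hxr (-n) n
      have h' : ‖f x‖ = ‖f (x - n)‖ * B n x := by
        simp only [hB]
        rw [← norm_prod, ← norm_mul]
        congr 1
        simpa [sub_eq_add_neg] using h
      have hB0 : 0 ≤ B n x := Finset.prod_nonneg fun _ _ => norm_nonneg _
      rw [Set.mem_ofPred_eq, div_le_iff₀ hε0]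
      refine le_of_mul_le_mul_right ?_ hfx
      calc 1 * ‖f x‖ = ‖f (x - n)‖ * B n x := by rw [one_mul, ← h']
        _ ≤ ε * ‖f x‖ * B n x := by gcongr
        _ = B n x * ε * ‖f x‖ := by ring
  obtain ⟨n₀, hn₀⟩ := ((tendsto_measure_iUnion_atTop (μ := volume) hUmono).eventually
    (lt_mem_nhds (hδE.trans_le hEU))).exists
  refine ⟨n₀, U n₀, hUm n₀, fun x hx => hx.1.2, hn₀, fun x hx n hn => ?_⟩
  exact ⟨(Set.mem_iInter₂.1 hx.2 n hn).1, (Set.mem_iInter₂.1 hx.2 n hn).2⟩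

theorem ae_eq_zero_of_good_approximation {C₀ C₁ C₂ : ℂ} (h₀ : C₀ ≠ 0) (h₁ : C₁ ≠ 0)
    (h₂ : C₂ ≠ 0) {α : ℝ} (hα : α ≠ 0) (β : ℝ) {C : ℝ} (hC0 : 0 ≤ C)
    (happ : ∀ N₀ : ℕ, ∃ N : ℕ, N₀ ≤ N ∧ ∃ p : ℤ, IsCoprime (N : ℤ) p ∧
      |N * (β / |α|) - p| ≤ C / (N * Real.log N))
    {f : ℝ → ℂ} (hf : Measurable f)
    (hrec : ∀ᵐ x : ℝ, f (x + 1) = f x * trinomial C₀ C₁ C₂ α β x)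
    (hdecay : ∀ᵐ x ∂(volume.restrict (Set.Ico (0 : ℝ) 1)),
      Tendsto (fun n : ℤ => f (x + n)) cofinite (nhds 0)) :
    f =ᵐ[volume] 0 := by
  set P := trinomial C₀ C₁ C₂ α β with hP
  have hPc : Continuous P := continuous_trinomial ..
  set a := |α| with ha'
  have ha : 0 < a := abs_pos.2 hα
  have hPne : ∀ᵐ x, P x ≠ 0 := (countable_trinomial_eq_zero h₀ h₁ hα β).ae_notMem _
  have hrec' := ae_forall_int_shift hrec
  have hPne' := ae_forall_int_shift hPne
  set E : Set ℝ := {x | f x ≠ 0} ∩ Set.Ico 0 1 with hE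
  have hEfin : volume E ≠ ⊤ :=
    ((measure_mono Set.inter_subset_right).trans_lt (by simp)).ne
  refine ae_eq_zero_of_ae_eq_zero_on_period hrec' hPne' ?_
  by_contra hEne
  set δ : ℝ := (volume E).toReal / 2 with hδ
  have hEpos : 0 < (volume E).toReal := ENNReal.toReal_pos hEne hEfin
  have hδ0 : 0 < δ := by positivity
  have hδE : ENNReal.ofReal δ < volume E := by
    rw [← ENNReal.ofReal_toReal hEfin]
    exact (ENNReal.ofReal_lt_ofReal_iff hEpos).2 (by rw [hδ]; linarith)
  obtain ⟨J, hJ⟩ := exists_nat_gt (4 / δ)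
  obtain ⟨A, hA, T₀, hbad⟩ := exists_measure_sum_inv_trinomial_gt_le h₀ h₁ h₂ β hα C (J + 1)
    (half_pos hδ0)
  set η : ℝ := ‖C₂‖ * (2 * Real.pi * (J * C)) with hη
  have hη0 : 0 ≤ η := by have := Real.pi_pos; positivity
  set ε : ℝ := Real.exp (-(η * A)) / 2 with hε
  have hε0 : 0 < ε := by positivity
  obtain ⟨n₀, U, hUm, hUI, hn₀, hUprod⟩ := exists_set_prod_norm_le hf hPc hrec' hdecay hε0 hδE
  -- Choose a large good denominator.
  have hloglim : Tendsto (fun n : ℕ => Real.log n) atTop atTop :=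
    Real.tendsto_log_atTop.comp tendsto_natCast_atTop_atTop
  obtain ⟨N₀, hN₀⟩ := eventually_atTop.1
    ((hloglim.eventually (eventually_ge_atTop (max 1 C))).and
      ((((tendsto_natCast_atTop_atTop (R := ℝ)).atTop_mul_atTop₀ hloglim).eventually
        (eventually_ge_atTop T₀)).and
      ((tendsto_natCast_atTop_atTop (R := ℝ)).eventually (eventually_ge_atTop (a * (n₀ + 1))))))
  obtain ⟨N, hN, p, hcop, hNp⟩ := happ N₀
  obtain ⟨hlog, hT₀, hNa⟩ := hN₀ N hN
  set T : ℝ := N * Real.log N with hT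
  set t : ℝ := N / a with ht
  have htn₀ : (n₀ : ℝ) + 1 ≤ t := by
    rw [ht, le_div_iff₀ ha, mul_comm]
    exact hNa
  have ht1 : 1 ≤ t := by
    have : (0 : ℝ) ≤ n₀ := Nat.cast_nonneg _
    linarith
  have hNpos : (0 : ℝ) < N := by
    have := div_mul_cancel₀ (N : ℝ) ha.ne'
    rw [← ht] at this
    nlinarith
  have hT0 : 0 < T := by
    have : 0 < Real.log N := by linarith [le_max_left 1 C]
    positivity
  set M : ℕ := ⌊(((J + 1) * N : ℕ) : ℝ) / a⌋₊ with hM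
  set V : Set ℝ := {x | (∀ k < M, P (x + k) ≠ 0) ∧
    ∑ k ∈ Finset.range M, ‖P (x + k)‖⁻¹ ≤ A * T} with hV
  have hVm : MeasurableSet V := by
    have h : V = (⋂ k ∈ Finset.range M, {x | P (x + (k : ℕ)) = 0}ᶜ) ∩
        {x | ∑ k ∈ Finset.range M, ‖P (x + k)‖⁻¹ ≤ A * T} := by
      ext x
      simp [hV]
    rw [h]
    refine (Finset.measurableSet_biInter _ fun k _ =>
      (isClosed_eq (by fun_prop) continuous_const).measurableSet.compl).inter ?_
    have hPm := hPc.measurable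
    exact measurableSet_le (by fun_prop) measurable_const
  have hVbad := hbad N p T ((le_max_left 1 C).trans hlog) ((le_max_right 1 C).trans hlog) hT hT₀
    hcop hNp M (Nat.floor_le (by positivity))
  have hDvol : ENNReal.ofReal (δ / 2) < volume (U ∩ V) := by
    have h1 : volume U ≤ volume (U ∩ V) + ENNReal.ofReal (δ / 2) := by
      rw [← measure_inter_add_sdiff U hVm]
      gcongr
      refine le_trans (measure_mono ?_) hVbad
      exact Set.sdiff_subset_sdiff_left hUI
    have h2 := hn₀.trans_le h1
    by_contra hle
    rw [not_lt] at hle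
    refine absurd h2 (not_lt.2 ?_)
    calc _ ≤ ENNReal.ofReal (δ / 2) + ENNReal.ofReal (δ / 2) := by gcongr
      _ = ENNReal.ofReal δ := by
        rw [← ENNReal.ofReal_add (by positivity) (by positivity), add_halves]
  obtain ⟨d, hd, d', hd', l, hl1, hlJ, n', hn'⟩ :=
    exists_translates_meet (hUm.inter hVm) (fun x hx => hUI hx.1) (J := J) (by
      refine lt_of_le_of_lt ?_ (ENNReal.mul_lt_mul_right (by simp) (by simp) hDvol)
      rw [← ENNReal.ofReal_natCast, ← ENNReal.ofReal_mul (by positivity),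
        show (2 : ENNReal) = ENNReal.ofReal 2 by simp]
      apply ENNReal.ofReal_le_ofReal
      rw [div_lt_iff₀ hδ0] at hJ
      push_cast
      nlinarith) t
  have hdI := hUI hd.1
  have hdI' := hUI hd'.1
  have hl1' : (1 : ℝ) ≤ l := by exact_mod_cast hl1
  have hlJ' : (l : ℝ) ≤ J := by exact_mod_cast hlJ
  have hlow : (n₀ : ℝ) < n' := by nlinarith [hdI.1, hdI'.2]
  have hn'0 : 0 ≤ n' := by
    have h : (0 : ℝ) < n' := lt_of_le_of_lt (Nat.cast_nonneg _) hlow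
    exact (by exact_mod_cast h : (0 : ℤ) < n').le
  obtain ⟨n, rfl⟩ := Int.eq_ofNat_of_zero_le hn'0
  simp only [Int.cast_natCast] at hlow hn'
  have hnn₀ : n₀ ≤ n := by exact_mod_cast hlow.le
  have hnM : n ≤ M := by
    apply Nat.le_floor
    have : (((J + 1) * N : ℕ) : ℝ) / a = (J + 1) * t := by
      rw [ht]; push_cast; ring
    rw [this]
    nlinarith [hdI.2, hdI'.1]
  have hFd := (hUprod d' hd'.1 n hnn₀).1
  have hBd := (hUprod d hd.1 n hnn₀).2
  have hcomp : ∏ k ∈ Finset.range n, ‖P (d - n + k)‖ ≤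
      (∏ k ∈ Finset.range n, ‖P (d' + k)‖) *
      Real.exp (η / T * ∑ k ∈ Finset.range n, ‖P (d' + k)‖⁻¹) := by
    refine prod_norm_le_prod_norm_mul_exp (g := fun k => P (d' + k))
      (h := fun k => P (d - n + k)) (fun k hk => hd'.2.1 k (hk.trans_le hnM)) fun k _ => ?_
    rw [show d - n + k = d' + k - l * t by rw [hn']; ring]
    refine (norm_trinomial_sub_le C₀ C₁ C₂ hα β l N p (d' + k)).trans ?_
    rw [hη, mul_div_assoc, mul_div_assoc, mul_div_assoc]
    have := Real.pi_pos
    gcongr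
  have hexp : Real.exp (η / T * ∑ k ∈ Finset.range n, ‖P (d' + k)‖⁻¹) ≤ Real.exp (η * A) := by
    apply Real.exp_le_exp.2
    have h1 : ∑ k ∈ Finset.range n, ‖P (d' + k)‖⁻¹ ≤ A * T :=
      le_trans (Finset.sum_le_sum_of_subset_of_nonneg
        (Finset.range_subset_range.2 hnM) fun _ _ _ => by positivity) hd'.2.2
    calc _ ≤ η / T * (A * T) := by gcongr
      _ = η * A := by field_simp
  have hfinal : 1 / ε ≤ 1 / 2 := by
    calc 1 / ε ≤ ε * Real.exp (η * A) := hBd.trans (hcomp.trans (by gcongr))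
      _ = 1 / 2 := by
        rw [hε, div_mul_eq_mul_div, ← Real.exp_add, neg_add_cancel, Real.exp_zero]
  have hε2 : ε ≤ 1 / 2 := by
    have : Real.exp (-(η * A)) ≤ 1 := Real.exp_le_one_iff.2 (by nlinarith)
    rw [hε]
    linarith
  rw [div_le_iff₀ hε0] at hfinal
  linarith

lemma exists_approximation_div_abs {α β C : ℝ} (N₀ : ℕ)
    (h : ∃ N : ℕ, N₀ ≤ N ∧ ∃ p : ℤ, IsCoprime (N : ℤ) p ∧
      |N * (β / α) - p| ≤ C / (N * Real.log N)) :
    ∃ N : ℕ, N₀ ≤ N ∧ ∃ p : ℤ, IsCoprime (N : ℤ) p ∧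
      |N * (β / |α|) - p| ≤ C / (N * Real.log N) := by
  obtain ⟨N, hN, p, hp, hle⟩ := h
  rcases abs_choice α with ha | ha
  · exact ⟨N, hN, p, hp, by rwa [ha]⟩
  · refine ⟨N, hN, -p, hp.neg_right, ?_⟩
    rw [ha, Int.cast_neg, div_neg, mul_neg, ← neg_add', abs_neg]
    exact hle

theorem stmt_14 (C₀ C₁ C₂ : ℂ) (h₀ : C₀ ≠ 0) (h₁ : C₁ ≠ 0) (h₂ : C₂ ≠ 0)
    (α β : ℝ) (hβ : β ≠ 0) (hirr : Irrational (α / β))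
    (hdio : ∃ C : ℝ, ∃ᶠ n : ℕ in atTop,
      (n : ℝ) * Real.log n *
        min (nint ((n : ℝ) * (β / α))) (nint ((n : ℝ) * (α / β))) ≤ C)
    (f : ℝ → ℂ) (hmeas : Measurable f)
    (hrec : ∀ᵐ x : ℝ ∂volume,
      f (x + 1) = f x *
        (C₀ + C₁ * Complex.exp (2 * (Real.pi : ℂ) * Complex.I * (α : ℂ) * (x : ℂ))
            + C₂ * Complex.exp (2 * (Real.pi : ℂ) * Complex.I * (β : ℂ) * (x : ℂ))))
    (hdecay : ∀ᵐ x ∂(volume.restrict (Set.Ico (0 : ℝ) 1)),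
      Tendsto (fun n : ℤ => f (x + n)) cofinite (nhds 0)) :
    f =ᵐ[volume] 0 := by
  have hα : α ≠ 0 := by
    rintro rfl
    simp at hirr
  have hexp : ∀ γ x : ℝ, Complex.exp (2 * (Real.pi : ℂ) * Complex.I * (γ : ℂ) * (x : ℂ)) =
      unitExp (γ * x) := by
    intro γ x
    rw [unitExp]
    congr 1
    push_cast
    ring
  simp only [hexp] at hrec
  obtain ⟨C, hC⟩ := hdio
  have hsplit : ∃ᶠ n : ℕ in atTop, (n : ℝ) * Real.log n * nint (n * (β / α)) ≤ C ∨
      (n : ℝ) * Real.log n * nint (n * (α / β)) ≤ C := by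
    refine hC.mono fun n hn => ?_
    rcases min_choice (nint ((n : ℝ) * (β / α))) (nint ((n : ℝ) * (α / β))) with h | h
    · left; rwa [h] at hn
    · right; rwa [h] at hn
  rcases frequently_or_distrib.1 hsplit with h | h
  · have hirr' : Irrational (β / α) := by
      rw [← inv_div]
      exact hirr.inv
    exact ae_eq_zero_of_good_approximation h₀ h₁ h₂ hα β (abs_nonneg C)
      (fun N₀ => exists_approximation_div_abs N₀ (exists_reduced_approximation hirr' h N₀))
      hmeas hrec hdecay
  · refine ae_eq_zero_of_good_approximation h₀ h₂ h₁ hβ α (abs_nonneg C)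
      (fun N₀ => exists_approximation_div_abs N₀ (exists_reduced_approximation hirr h N₀))
      hmeas ?_ hdecay
    filter_upwards [hrec] with x hx
    rw [hx, trinomial, add_right_comm]
end
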